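/- Fix θ ∈ (0,1), ν > 0 and constants 0 < a ≤ b. For each N, let K = K(N) be a natural number with a·N^θ ≤ K ≤ b·N^θ, let T = T(N) be a number of tests, and run the near-constant column weight design with per-item weight L = ⌊ν·T/K⌋. Suppose liminf_{N→∞} log₂(binom(N,K))/T(N) > min{ 1, (ln 2)·(1−θ)/θ }. Then for any sequence of decoding rules 𝒦̂_N (arbitrary functions of the realized test matrix X and the outcome vector y, producing a subset of the items), the success probability P(𝒦̂_N = 𝒦) does not converge to 1 as N → ∞; it is bounded away from 1 along a subsequence. -/

import Mathlib

open Filter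

/-- Success probability of an arbitrary decoding rule `dec` (a function of the realized binary
test matrix and the outcome vector) under the near-constant column weight design: the defective
set is uniform over the `K`-subsets of the `N` items, and independently each item picks `L`
tests uniformly at random with replacement from the `T` tests.  The test matrix entry `(t, i)`
records whether test `t` contains item `i`; the outcome of test `t` records whether `t` contains
a defective item. -/
noncomputable def decodeSuccessProb (N K T L : ℕ)
    (dec : (Fin T → Fin N → Bool) → (Fin T → Bool) → Finset (Fin N)) : ℝ :=
  (Nat.card {ω : {S : Finset (Fin N) // S.card = K} × (Fin N → Fin L → Fin T) //
      dec (fun t i => decide (∃ l, ω.2 i l = t))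
          (fun t => decide (∃ i ∈ ω.1.1, ∃ l, ω.2 i l = t)) = ω.1.1} : ℝ) /
    (Nat.card ({S : Finset (Fin N) // S.card = K} × (Fin N → Fin L → Fin T)) : ℝ)

open Finset in
/-- A decoder that sees `f ω` is right on at most one `ω` for each observation. -/
lemma card_decoded_le {Ω O V : Type*} [Fintype Ω] [Fintype O] [DecidableEq V]
    (f : Ω → O) (g : O → V) (v : Ω → V)
    (hinj : ∀ ω ω', f ω = f ω' → v ω = v ω' → ω = ω') :
    #{ω | g (f ω) = v ω} ≤ Fintype.card O := by
  classical
  refine Finset.card_le_card_of_injOn f (fun _ _ => Finset.mem_univ _) ?_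
  intro ω hω ω' hω' h
  simp only [coe_filter, mem_univ, true_and, Set.mem_ofPred_eq] at hω hω'
  exact hinj _ _ h (by rw [← hω, ← hω', h])

open Finset in
open scoped Classical in
/-- A decoder that sees `f ω` is wrong on at least half of the points whose observation is shared
with another point. -/
lemma two_mul_card_decoded_add_card_ambiguous_le {Ω O V : Type*} [Fintype Ω]
    (f : Ω → O) (g : O → V) (v : Ω → V)
    (hinj : ∀ ω ω', f ω = f ω' → v ω = v ω' → ω = ω') :
    2 * #{ω | g (f ω) = v ω} + #{ω | ∃ ω', f ω' = f ω ∧ ω' ≠ ω} ≤ 2 * Fintype.card Ω := by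
  have hsplit := Finset.card_filter_add_card_filter_not (s := (univ : Finset Ω))
    (fun ω => g (f ω) = v ω)
  have hamb : #{ω | ∃ ω', f ω' = f ω ∧ ω' ≠ ω} ≤
      #{ω | ¬ g (f ω) = v ω} + #{ω | (∃ ω', f ω' = f ω ∧ ω' ≠ ω) ∧ g (f ω) = v ω} := by
    refine (card_le_card ?_).trans (card_union_le _ _)
    intro ω
    simp only [mem_filter, mem_univ, true_and, mem_union]
    tauto
  have hpartner : #{ω | (∃ ω', f ω' = f ω ∧ ω' ≠ ω) ∧ g (f ω) = v ω} ≤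
      #{ω | ¬ g (f ω) = v ω} := by
    refine Finset.card_le_card_of_injOn
      (fun ω => if h : ∃ ω', f ω' = f ω ∧ ω' ≠ ω then h.choose else ω) ?_ ?_
    · intro ω hω
      simp only [coe_filter, mem_univ, true_and, Set.mem_ofPred_eq] at hω ⊢
      rw [dif_pos hω.1]
      obtain ⟨h1, h2⟩ := hω.1.choose_spec
      intro h
      exact h2 (hinj _ _ h1 (h.symm.trans ((congrArg g h1).trans hω.2)))
    · intro ω hω ω' hω' h
      simp only [coe_filter, mem_univ, true_and, Set.mem_ofPred_eq] at hω hω' h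
      rw [dif_pos hω.1, dif_pos hω'.1] at h
      have hf : f ω = f ω' := by
        rw [← hω.1.choose_spec.1, ← hω'.1.choose_spec.1, h]
      exact hinj _ _ hf (by rw [← hω.2, ← hω'.2, hf])
  rw [Finset.card_univ] at hsplit
  omega

open Finset in
open scoped Classical in
/-- If the coordinates in `D` are required to lie in a set of size at most `q` determined by the
other coordinates, each of them contributes a factor at most `q`. -/
lemma card_filter_forall_mem_le {ι A : Type*} [Fintype ι] [Fintype A]
    (D : Finset ι) (E : (ι → A) → Prop) (M : (ι → A) → Finset A)
    (hM : ∀ x y : ι → A, (∀ i ∉ D, x i = y i) → M x = M y)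
    (q : ℕ) (hq : ∀ x, E x → #(M x) ≤ q) :
    #{x : ι → A | E x ∧ ∀ i ∈ D, x i ∈ M x} ≤
      q ^ #D * Fintype.card A ^ (Fintype.card ι - #D) := by
  set s : Finset (ι → A) := {x : ι → A | E x ∧ ∀ i ∈ D, x i ∈ M x} with hs
  let ρ : (ι → A) → ({i // i ∉ D} → A) := fun x i => x i
  have h1 : #s ≤ q ^ #D * #(s.image ρ) := by
    refine Finset.card_le_mul_card_image s _ ?_
    intro y hy
    obtain ⟨x₀, hx₀, rfl⟩ := Finset.mem_image.1 hy
    have hx₀E : E x₀ := by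
      rw [hs, mem_filter] at hx₀
      exact hx₀.2.1
    have hsub : {x ∈ s | ρ x = ρ x₀} ⊆
        Fintype.piFinset (fun i => if i ∈ D then M x₀ else {x₀ i}) := by
      intro x hx
      rw [mem_filter, hs, mem_filter] at hx
      have hoff : ∀ i ∉ D, x i = x₀ i := fun i hi => congrFun hx.2 ⟨i, hi⟩
      rw [Fintype.mem_piFinset]
      intro i
      split_ifs with hi
      · rw [← hM x x₀ hoff]
        exact hx.1.2.2 i hi
      · simpa using hoff i hi
    refine (card_le_card hsub).trans ?_
    rw [Fintype.card_piFinset]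
    have : ∀ i, #(if i ∈ D then M x₀ else {x₀ i}) = if i ∈ D then #(M x₀) else 1 := by
      intro i; split_ifs <;> simp
    simp only [this]
    rw [Finset.prod_ite]
    simp only [prod_const, one_pow, mul_one, Finset.filter_mem_eq_inter, Finset.univ_inter]
    exact Nat.pow_le_pow_left (hq _ hx₀E) _
  refine h1.trans (Nat.mul_le_mul_left _ ?_)
  refine (Finset.card_le_univ _).trans (le_of_eq ?_)
  rw [Fintype.card_fun]
  congr 1
  rw [Fintype.card_subtype_compl, Fintype.card_coe]

/-- The tests that contain some item of `B`. -/
def positiveTests {N T L : ℕ} (B : Finset (Fin N)) (x : Fin N → Fin L → Fin T) :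
    Finset (Fin T) :=
  {t | ∃ i ∈ B, ∃ l, x i l = t}

open Finset in
/-- Exchanging a defective item and a nondefective item, both covered by the remaining defectives,
leaves the outcome unchanged. -/
lemma exists_ne_positiveTests_eq {N T L : ℕ} {S D : Finset (Fin N)} (hD : D ⊆ S)
    (x : Fin N → Fin L → Fin T) {i j : Fin N} (hi : i ∈ D) (hj : j ∉ S)
    (hxi : ∀ l, x i l ∈ positiveTests (S \ D) x) (hxj : ∀ l, x j l ∈ positiveTests (S \ D) x) :
    ∃ S' : Finset (Fin N), #S' = #S ∧ S' ≠ S ∧ positiveTests S' x = positiveTests S x := by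
  have hjS : j ∉ S.erase i := fun h => hj (mem_of_mem_erase h)
  refine ⟨insert j (S.erase i), ?_, ?_, ?_⟩
  · rw [card_insert_of_notMem hjS, card_erase_of_mem (hD hi)]
    have := card_pos.2 ⟨i, hD hi⟩
    omega
  · intro h
    exact hj (h ▸ mem_insert_self _ _)
  · simp only [positiveTests, mem_filter, mem_univ, true_and, Finset.mem_sdiff] at hxi hxj
    ext t
    simp only [positiveTests, mem_filter, mem_univ, true_and, mem_insert, mem_erase]
    constructor
    · rintro ⟨k, rfl | ⟨-, hk⟩, l, rfl⟩
      · obtain ⟨k', hk', l', h⟩ := hxj l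
        exact ⟨k', hk'.1, l', h⟩
      · exact ⟨k, hk, l, rfl⟩
    · rintro ⟨k, hk, l, rfl⟩
      by_cases hki : k = i
      · subst hki
        obtain ⟨k', hk', l', h⟩ := hxi l
        refine ⟨k', Or.inr ⟨?_, hk'.1⟩, l', h⟩
        rintro rfl
        exact hk'.2 hi
      · exact ⟨k, Or.inr ⟨hki, hk⟩, l, rfl⟩

open Finset in
lemma sum_card_compl_positiveTests {N T L : ℕ} (hT : 0 < T) (B : Finset (Fin N)) :
    (∑ x : Fin N → Fin L → Fin T, (#(positiveTests B x)ᶜ : ℝ)) =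
      T * ((T : ℝ) ^ L) ^ N * (1 - 1 / T : ℝ) ^ (L * #B) := by
  classical
  have h1 : ∀ x : Fin N → Fin L → Fin T, (#(positiveTests B x)ᶜ : ℝ) =
      ∑ t : Fin T, if t ∉ positiveTests B x then (1 : ℝ) else 0 := by
    intro x
    rw [Finset.sum_boole]
    congr 2
    ext t
    simp
  have h2 : ∀ t : Fin T, (∑ x : Fin N → Fin L → Fin T,
      if t ∉ positiveTests B x then (1 : ℝ) else 0) =
      ((T : ℝ) ^ L) ^ N * (1 - 1 / T : ℝ) ^ (L * #B) := by
    intro t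
    rw [Finset.sum_boole]
    have hset : ({x : Fin N → Fin L → Fin T | t ∉ positiveTests B x} : Finset _) =
        Fintype.piFinset (fun i => if i ∈ B then
          Fintype.piFinset (fun _ : Fin L => ({t}ᶜ : Finset (Fin T))) else univ) := by
      ext x
      simp only [positiveTests, mem_filter, mem_univ, true_and, Fintype.mem_piFinset, not_exists,
        not_and]
      refine forall_congr' fun i => ?_
      split_ifs with hi <;> simp [hi]
    rw [hset, Fintype.card_piFinset]
    have hc : ∀ i, #(if i ∈ B then Fintype.piFinset (fun _ : Fin L => ({t}ᶜ : Finset (Fin T)))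
        else univ) = if i ∈ B then (T - 1) ^ L else T ^ L := by
      intro i
      split_ifs
      · simp [Fintype.card_piFinset, card_compl]
      · simp
    simp only [hc]
    rw [Finset.prod_ite]
    simp only [prod_const, filter_not, Finset.filter_mem_eq_inter, Finset.univ_inter,
      ← compl_eq_univ_sdiff, card_compl, Fintype.card_fin]
    have hBN : #B ≤ N := by simpa using Finset.card_le_univ B
    have hTr : (T : ℝ) ≠ 0 := by positivity
    have hfrac : (1 - 1 / T : ℝ) = (T - 1) / T := by field_simp
    push_cast [Nat.cast_sub hT]
    rw [hfrac, pow_mul, div_pow, div_pow]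
    have hN : ((T : ℝ) ^ L) ^ N = ((T : ℝ) ^ L) ^ #B * ((T : ℝ) ^ L) ^ (N - #B) := by
      rw [← pow_add, Nat.add_sub_cancel' hBN]
    rw [hN]
    field_simp
  simp_rw [h1]
  rw [Finset.sum_comm]
  simp_rw [h2]
  simp [mul_assoc]

open Finset in
lemma card_compl_positiveTests_gt_le {N T L : ℕ} (hT : 0 < T) (B : Finset (Fin N))
    {δ s : ℝ} (hδ : 0 < δ) (hs : 0 < s)
    (hsB : (1 + δ) * (1 - 1 / T : ℝ) ^ (L * #B) ≤ s) :
    (#{x : Fin N → Fin L → Fin T | s * T < #(positiveTests B x)ᶜ} : ℝ) ≤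
      1 / (1 + δ) * ((T : ℝ) ^ L) ^ N := by
  have hTr : (0 : ℝ) < T := by positivity
  have h1 : (#{x : Fin N → Fin L → Fin T | s * T < #(positiveTests B x)ᶜ} : ℝ) * (s * T) ≤
      ∑ x : Fin N → Fin L → Fin T, (#(positiveTests B x)ᶜ : ℝ) := by
    rw [← nsmul_eq_mul]
    refine (Finset.card_nsmul_le_sum _ (fun x => (#(positiveTests B x)ᶜ : ℝ)) _ ?_).trans
      (Finset.sum_le_univ_sum_of_nonneg fun x => by positivity)
    intro x hx
    exact (mem_filter.1 hx).2.le
  rw [sum_card_compl_positiveTests hT] at h1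
  have h2 : (1 - 1 / T : ℝ) ^ (L * #B) ≤ s / (1 + δ) := by
    rw [le_div_iff₀ (by positivity)]
    linarith
  have h3 : (T : ℝ) * (T ^ L) ^ N * (1 - 1 / T : ℝ) ^ (L * #B) ≤
      T * (T ^ L) ^ N * (s / (1 + δ)) := by gcongr
  have h4 : (T : ℝ) * (T ^ L) ^ N * (s / (1 + δ)) = 1 / (1 + δ) * (T ^ L) ^ N * (s * T) := by
    ring
  exact le_of_mul_le_mul_right (h1.trans (h3.trans h4.le)) (by positivity)

open Finset in
lemma card_forall_not_covered_le {N T L m : ℕ} (hT : 0 < T) (B D : Finset (Fin N))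
    (hBD : Disjoint B D) (hm : m ≤ #D) {s : ℝ} (hs0 : 0 < s) (hs1 : s ≤ 1) :
    (#{x : Fin N → Fin L → Fin T | (#(positiveTests B x)ᶜ : ℝ) ≤ s * T ∧
        ∀ i ∈ D, ¬ ∀ l, x i l ∈ positiveTests B x} : ℝ) ≤
      Real.exp (-(m * (1 - s) ^ L)) * ((T : ℝ) ^ L) ^ N := by
  classical
  have hTr : (0 : ℝ) < T := by positivity
  have hp1 : (1 - s) ^ L ≤ 1 := pow_le_one₀ (by linarith) (by linarith)
  have hp0 : 0 ≤ (1 - s) ^ L := pow_nonneg (by linarith) _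
  have hDN : #D ≤ N := by simpa using Finset.card_le_univ D
  have key := card_filter_forall_mem_le D
    (fun x : Fin N → Fin L → Fin T => (#(positiveTests B x)ᶜ : ℝ) ≤ s * T)
    (fun x => (Fintype.piFinset fun _ : Fin L => positiveTests B x)ᶜ) ?_
    ⌊(1 - (1 - s) ^ L) * (T : ℝ) ^ L⌋₊ ?_
  · simp only [mem_compl, Fintype.mem_piFinset, Fintype.card_fun, Fintype.card_fin] at key
    have key' : (#{x : Fin N → Fin L → Fin T | (#(positiveTests B x)ᶜ : ℝ) ≤ s * T ∧
        ∀ i ∈ D, ¬ ∀ l, x i l ∈ positiveTests B x} : ℝ) ≤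
        (⌊(1 - (1 - s) ^ L) * (T : ℝ) ^ L⌋₊ : ℝ) ^ #D * ((T : ℝ) ^ L) ^ (N - #D) := by
      have key₂ := (Nat.cast_le (α := ℝ)).2 key
      push_cast at key₂
      refine le_trans (le_of_eq ?_) key₂
      congr!
    refine key'.trans ?_
    have hfl : (⌊(1 - (1 - s) ^ L) * (T : ℝ) ^ L⌋₊ : ℝ) ≤ (1 - (1 - s) ^ L) * (T : ℝ) ^ L :=
      Nat.floor_le (mul_nonneg (by linarith) (by positivity))
    calc _ ≤ ((1 - (1 - s) ^ L) * (T : ℝ) ^ L) ^ #D * ((T : ℝ) ^ L) ^ (N - #D) := by gcongr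
      _ = (1 - (1 - s) ^ L) ^ #D * ((T : ℝ) ^ L) ^ N := by
          rw [mul_pow, mul_assoc, ← pow_add, Nat.add_sub_cancel' hDN]
      _ ≤ Real.exp (-(m * (1 - s) ^ L)) * ((T : ℝ) ^ L) ^ N := by
          gcongr
          calc (1 - (1 - s) ^ L) ^ #D ≤ (1 - (1 - s) ^ L) ^ m :=
                pow_le_pow_of_le_one (by linarith) (by linarith) hm
            _ ≤ (Real.exp (-(1 - s) ^ L)) ^ m :=
                pow_le_pow_left₀ (by linarith) (Real.one_sub_le_exp_neg _) _
            _ = _ := by rw [← Real.exp_nat_mul]; ring_nf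
  · intro x y hxy
    have : positiveTests B x = positiveTests B y := by
      ext t
      simp only [positiveTests, mem_filter, mem_univ, true_and]
      refine exists_congr fun i => and_congr_right fun hi => ?_
      rw [hxy i (Finset.disjoint_left.1 hBD hi)]
    simp only [this]
  · intro x hx
    apply Nat.le_floor
    have hc : #(positiveTests B x) ≤ T := by simpa using Finset.card_le_univ (positiveTests B x)
    rw [card_compl, Fintype.card_fin, Nat.cast_sub hc] at hx
    rw [card_compl, Fintype.card_piFinset_const, Fintype.card_fun, Fintype.card_fin,
      Nat.cast_sub (by rw [Fintype.card_fin]; exact Nat.pow_le_pow_left hc _)]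
    have h2 : ((1 - s) * T) ^ L ≤ (#(positiveTests B x) : ℝ) ^ L :=
      pow_le_pow_left₀ (mul_nonneg (by linarith) hTr.le) (by linarith) _
    rw [mul_pow] at h2
    simp only [Fintype.card_fin]
    push_cast
    linarith

open Finset in
open scoped Classical in
lemma card_unambiguous_le {N T L m : ℕ} (hT : 0 < T) (S : Finset (Fin N)) (hmS : m ≤ #S)
    (hmN : #S + m ≤ N) {δ s : ℝ} (hδ : 0 < δ) (hs0 : 0 < s) (hs1 : s ≤ 1)
    (hsB : (1 + δ) * (1 - 1 / T : ℝ) ^ (L * (#S - m)) ≤ s) :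
    (#{x : Fin N → Fin L → Fin T | ¬ ∃ S' : Finset (Fin N), #S' = #S ∧ S' ≠ S ∧
        positiveTests S' x = positiveTests S x} : ℝ) ≤
      (1 / (1 + δ) + 2 * Real.exp (-(m * (1 - s) ^ L))) * ((T : ℝ) ^ L) ^ N := by
  obtain ⟨D, hDS, hDm⟩ := Finset.exists_subset_card_eq hmS
  have hB : #(S \ D) = #S - m := by rw [card_sdiff_of_subset hDS, hDm]
  have h1 := card_compl_positiveTests_gt_le (L := L) hT (S \ D) hδ hs0 (by rwa [hB])
  have h2 := card_forall_not_covered_le (L := L) hT (S \ D) D sdiff_disjoint hDm.ge hs0 hs1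
  have h3 := card_forall_not_covered_le (L := L) (m := m) hT (S \ D) Sᶜ
    (disjoint_compl_right.mono_left sdiff_subset)
    (by rw [card_compl, Fintype.card_fin]; omega) hs0 hs1
  refine le_trans (?_ : _ ≤ _ + (_ + _)) ((add_le_add h1 (add_le_add h2 h3)).trans
    (le_of_eq (by ring)))
  norm_cast
  refine (card_le_card ?_).trans ((card_union_le _ _).trans
    (Nat.add_le_add_left (card_union_le _ _) _))
  intro x hx
  simp only [mem_filter, mem_univ, true_and, mem_union, mem_compl] at hx ⊢
  by_contra! hcon
  obtain ⟨hc1, hc2, hc3⟩ := hcon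
  obtain ⟨i, hi, hxi⟩ := hc2 hc1
  obtain ⟨j, hj, hxj⟩ := hc3 hc1
  exact hx (exists_ne_positiveTests_eq hDS x hi hj hxi hxj)

open Finset in
lemma decodeSuccessProb_eq (N K T L : ℕ)
    (dec : (Fin T → Fin N → Bool) → (Fin T → Bool) → Finset (Fin N)) :
    decodeSuccessProb N K T L dec =
      (#{ω : {S : Finset (Fin N) // #S = K} × (Fin N → Fin L → Fin T) |
        dec (fun t i => decide (∃ l, ω.2 i l = t))
          (fun t => decide (∃ i ∈ ω.1.1, ∃ l, ω.2 i l = t)) = ω.1.1} : ℝ) /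
      (N.choose K * ((T : ℝ) ^ L) ^ N) := by
  rw [decodeSuccessProb, Nat.card_eq_fintype_card, Nat.card_eq_fintype_card,
    Fintype.card_subtype, Fintype.card_prod, Fintype.card_finset_len]
  simp

open Finset in
lemma decodeSuccessProb_le_two_pow_div {N K T L : ℕ} (hT : 0 < T)
    (dec : (Fin T → Fin N → Bool) → (Fin T → Bool) → Finset (Fin N)) :
    decodeSuccessProb N K T L dec ≤ 2 ^ T / N.choose K := by
  have hTr : (0 : ℝ) < T := by positivity
  rw [decodeSuccessProb_eq]
  have h := card_decoded_le
    (fun ω : {S : Finset (Fin N) // #S = K} × (Fin N → Fin L → Fin T) =>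
      (ω.2, fun t => decide (∃ i ∈ ω.1.1, ∃ l, ω.2 i l = t)))
    (fun o => dec (fun t i => decide (∃ l, o.1 i l = t)) o.2) (fun ω => ω.1.1)
    (fun ω ω' h1 h2 => Prod.ext (Subtype.ext h2) (congrArg Prod.fst h1))
  simp only [Fintype.card_prod, Fintype.card_fun, Fintype.card_fin, Fintype.card_bool] at h
  rw [← mul_div_mul_right (2 ^ T : ℝ) _ (c := ((T : ℝ) ^ L) ^ N) (by positivity)]
  gcongr
  rw [mul_comm]
  exact_mod_cast h

open Finset in
lemma decodeSuccessProb_le_of_cover {N K T L m : ℕ} (hT : 0 < T) (hmK : m ≤ K) (hmN : K + m ≤ N)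
    {δ s : ℝ} (hδ : 0 < δ) (hs0 : 0 < s) (hs1 : s ≤ 1)
    (hsB : (1 + δ) * (1 - 1 / T : ℝ) ^ (L * (K - m)) ≤ s)
    (dec : (Fin T → Fin N → Bool) → (Fin T → Bool) → Finset (Fin N)) :
    decodeSuccessProb N K T L dec ≤
      1 / 2 + 1 / 2 * (1 / (1 + δ) + 2 * Real.exp (-(m * (1 - s) ^ L))) := by
  classical
  have hTr : (0 : ℝ) < T := by positivity
  have hCpos : 0 < N.choose K := Nat.choose_pos (by omega)
  rw [decodeSuccessProb_eq, div_le_iff₀ (by positivity)]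
  set c : ℝ := 1 / (1 + δ) + 2 * Real.exp (-(m * (1 - s) ^ L)) with hc
  let Ω := {S : Finset (Fin N) // #S = K} × (Fin N → Fin L → Fin T)
  let f : Ω → (Fin N → Fin L → Fin T) × (Fin T → Bool) :=
    fun ω => (ω.2, fun t => decide (∃ i ∈ ω.1.1, ∃ l, ω.2 i l = t))
  have h := two_mul_card_decoded_add_card_ambiguous_le f
    (fun o => dec (fun t i => decide (∃ l, o.1 i l = t)) o.2) (fun ω => ω.1.1)
    (fun ω ω' h1 h2 => Prod.ext (Subtype.ext h2) (congrArg Prod.fst h1))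
  have hsplit := Finset.card_filter_add_card_filter_not (s := (univ : Finset Ω))
    (fun ω => ∃ ω', f ω' = f ω ∧ ω' ≠ ω)
  have hΩ : (Fintype.card Ω : ℝ) = N.choose K * ((T : ℝ) ^ L) ^ N := by
    simp [Ω, Fintype.card_finset_len]
  have hun : (#{ω : Ω | ¬ ∃ ω', f ω' = f ω ∧ ω' ≠ ω} : ℝ) ≤
      N.choose K * (c * ((T : ℝ) ^ L) ^ N) := by
    have hfib : #{ω : Ω | ¬ ∃ ω', f ω' = f ω ∧ ω' ≠ ω} ≤
        ∑ S : {S : Finset (Fin N) // #S = K}, #{x : Fin N → Fin L → Fin T |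
          ¬ ∃ S' : Finset (Fin N), #S' = #S.1 ∧ S' ≠ S.1 ∧
            positiveTests S' x = positiveTests S.1 x} := by
      rw [← Finset.card_sigma]
      refine Finset.card_le_card_of_injOn (fun ω => ⟨ω.1, ω.2⟩) ?_ ?_
      · rintro ⟨S, x⟩ hω
        simp only [coe_filter, mem_univ, true_and, Set.mem_ofPred_eq] at hω
        simp only [coe_sigma, Set.mem_sigma_iff, coe_filter, coe_univ, Set.mem_univ, mem_univ,
          true_and, Set.mem_ofPred_eq]
        rintro ⟨S', h1, h2, h3⟩
        refine hω ⟨(⟨S', h1.trans S.2⟩, x), ?_, fun h => h2 (congrArg (fun ω : Ω => ω.1.1) h)⟩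
        refine Prod.ext rfl (funext fun t => ?_)
        have := Finset.ext_iff.1 h3 t
        simp only [positiveTests, mem_filter, mem_univ, true_and] at this
        exact decide_eq_decide.2 this
      · rintro ⟨S, x⟩ - ⟨S', x'⟩ - h
        simp only [Sigma.mk.injEq, heq_eq_eq] at h
        exact Prod.ext h.1 h.2
    refine (Nat.cast_le.2 hfib).trans ?_
    rw [Nat.cast_sum]
    refine (Finset.sum_le_card_nsmul _ _ (c * ((T : ℝ) ^ L) ^ N) ?_).trans (le_of_eq ?_)
    · rintro ⟨S, rfl⟩ -
      exact card_unambiguous_le hT S hmK hmN hδ hs0 hs1 hsB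
    · rw [Finset.card_univ, Fintype.card_finset_len, Fintype.card_fin, nsmul_eq_mul]
  rw [Finset.card_univ] at hsplit
  have hsplit' : (#{ω : Ω | ∃ ω', f ω' = f ω ∧ ω' ≠ ω} : ℝ) +
    #{ω : Ω | ¬ ∃ ω', f ω' = f ω ∧ ω' ≠ ω} = Fintype.card Ω := by exact_mod_cast hsplit
  have h' : 2 * (#{ω : Ω | dec (fun t i => decide (∃ l, ω.2 i l = t))
          (fun t => decide (∃ i ∈ ω.1.1, ∃ l, ω.2 i l = t)) = ω.1.1} : ℝ) +
      #{ω : Ω | ∃ ω', f ω' = f ω ∧ ω' ≠ ω} ≤ 2 * Fintype.card Ω := by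
    have h2 := (Nat.cast_le (α := ℝ)).2 h
    push_cast at h2
    refine le_trans (le_of_eq ?_) h2
    congr!
  rw [hΩ] at hsplit' h'
  refine le_trans ?_ (show (2 * (N.choose K * ((T : ℝ) ^ L) ^ N) -
    (N.choose K * ((T : ℝ) ^ L) ^ N - N.choose K * (c * ((T : ℝ) ^ L) ^ N))) / 2 ≤ _ by
      linarith)
  rw [le_div_iff₀ two_pos]
  linarith

lemma mul_log_le_one_sub_mul_log_one_sub {x : ℝ} (hx0 : 0 ≤ x) (hx1 : x ≤ 1 / 2) :
    x * Real.log x ≤ (1 - x) * Real.log (1 - x) := by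
  have hcont : Continuous fun y : ℝ => (1 - y) * Real.log (1 - y) - y * Real.log y :=
    (Real.continuous_mul_log.comp (continuous_const.sub continuous_id)).sub
      Real.continuous_mul_log
  have hderiv : ∀ y ∈ Set.Ioo (0 : ℝ) (1 / 2),
      HasDerivAt (fun y : ℝ => (1 - y) * Real.log (1 - y) - y * Real.log y)
        (-2 - Real.log (y * (1 - y))) y := by
    rintro y ⟨hy0, hy1⟩
    have h1 := (Real.hasDerivAt_mul_log (x := 1 - y) (by linarith)).comp_const_sub 1 y
    have h2 := Real.hasDerivAt_mul_log hy0.ne'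
    refine (h1.sub h2).congr_deriv ?_
    rw [Real.log_mul hy0.ne' (by linarith)]
    ring
  have hconc : ConcaveOn ℝ (Set.Icc (0 : ℝ) (1 / 2))
      fun y : ℝ => (1 - y) * Real.log (1 - y) - y * Real.log y := by
    refine AntitoneOn.concaveOn_of_deriv (convex_Icc _ _) hcont.continuousOn ?_ ?_
    · rw [interior_Icc]
      exact fun y hy => (hderiv y hy).differentiableAt.differentiableWithinAt
    · rw [interior_Icc]
      intro y hy z hz hyz
      rw [(hderiv y hy).deriv, (hderiv z hz).deriv]
      have := Real.log_le_log (mul_pos hy.1 (by linarith [hy.2]))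
        (show y * (1 - y) ≤ z * (1 - z) by nlinarith [hy.2, hz.2])
      linarith
  have h := hconc.min_le_of_mem_Icc (x := 0) (y := 1 / 2) (by norm_num) (by norm_num)
    (z := x) ⟨hx0, hx1⟩
  norm_num at h
  linarith

lemma log_mul_log_one_sub_le {x : ℝ} (hx0 : 0 < x) (hx1 : x < 1) :
    Real.log x * Real.log (1 - x) ≤ Real.log 2 ^ 2 := by
  wlog hx : x ≤ 1 / 2 generalizing x
  · have := this (x := 1 - x) (by linarith) (by linarith) (by linarith)
    rwa [sub_sub_cancel, mul_comm] at this
  have hderiv : ∀ y ∈ Set.Ioc (0 : ℝ) (1 / 2),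
      HasDerivAt (fun y : ℝ => Real.log y * Real.log (1 - y))
        (y⁻¹ * Real.log (1 - y) + Real.log y * -(1 - y)⁻¹) y := by
    rintro y ⟨hy0, hy1⟩
    exact (Real.hasDerivAt_log hy0.ne').mul
      ((Real.hasDerivAt_log (x := 1 - y) (by linarith)).comp_const_sub 1 y)
  have hmono : MonotoneOn (fun y : ℝ => Real.log y * Real.log (1 - y))
      (Set.Ioc (0 : ℝ) (1 / 2)) := by
    refine monotoneOn_of_deriv_nonneg (convex_Ioc _ _)
      (fun y hy => (hderiv y hy).continuousAt.continuousWithinAt) ?_ ?_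
    · rw [interior_Ioc]
      exact fun y hy =>
        (hderiv y (Set.Ioo_subset_Ioc_self hy)).differentiableAt.differentiableWithinAt
    · rw [interior_Ioc]
      intro y hy
      rw [(hderiv y (Set.Ioo_subset_Ioc_self hy)).deriv]
      have h0 : 0 < y := hy.1
      have h1 : 0 < 1 - y := by linarith [hy.2]
      have := mul_log_le_one_sub_mul_log_one_sub hy.1.le hy.2.le
      have heq : y⁻¹ * Real.log (1 - y) + Real.log y * -(1 - y)⁻¹ =
          ((1 - y) * Real.log (1 - y) - y * Real.log y) / (y * (1 - y)) := by
        field_simp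
        ring
      rw [heq]
      exact div_nonneg (by linarith) (by positivity)
  have h := hmono ⟨hx0, hx⟩ (show (1 / 2 : ℝ) ∈ Set.Ioc (0 : ℝ) (1 / 2) by norm_num) hx
  refine h.trans (le_of_eq ?_)
  simp only [one_div, Real.log_inv]
  rw [show (1 - 2⁻¹ : ℝ) = 2⁻¹ by norm_num, Real.log_inv]
  ring

lemma neg_mul_log_one_sub_exp_neg_le {ν : ℝ} (hν : 0 < ν) :
    -(ν * Real.log (1 - Real.exp (-ν))) ≤ Real.log 2 ^ 2 := by
  have h := log_mul_log_one_sub_le (Real.exp_pos (-ν)) (Real.exp_lt_one_iff.2 (by linarith))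
  rw [Real.log_exp] at h
  linarith

lemma log_choose_le {N K : ℕ} (hK : 0 < K) (hKN : K ≤ N) :
    Real.log (N.choose K) ≤ K * (Real.log N + 1 - Real.log K) := by
  have hK1 : (1 : ℝ) ≤ K := by exact_mod_cast hK
  have hN : (0 : ℝ) < N := by exact_mod_cast hK.trans_le hKN
  have hC : (0 : ℝ) < N.choose K := by exact_mod_cast Nat.choose_pos hKN
  have h1 := Real.log_le_log hC (Nat.choose_le_pow_div (α := ℝ) K N)
  rw [Real.log_div (by positivity) (by positivity), Real.log_pow] at h1
  have h2 := Stirling.le_log_factorial_stirling hK.ne'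
  have h3 := Real.log_nonneg hK1
  have h4 : 0 ≤ Real.log (2 * Real.pi) := Real.log_nonneg (by linarith [Real.pi_gt_three])
  linarith

lemma le_log_choose {N K : ℕ} (hK : 0 < K) (hKN : 2 * K ≤ N) :
    K * (Real.log N - Real.log 2 - Real.log K) ≤ Real.log (N.choose K) := by
  have hKr : (0 : ℝ) < K := by exact_mod_cast hK
  have hN : (0 : ℝ) < N := by exact_mod_cast (by omega : 0 < N)
  have h2 : (N / 2 : ℝ) ^ K / (K : ℝ) ^ K ≤ N.choose K := by
    refine le_trans ?_ (Nat.pow_le_choose (α := ℝ) K N)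
    gcongr
    · rw [Nat.cast_sub (by omega)]
      have : (2 * K : ℝ) ≤ N := by exact_mod_cast hKN
      push_cast
      linarith
    · exact_mod_cast Nat.factorial_le_pow K
  have h3 := Real.log_le_log (by positivity) h2
  rw [Real.log_div (by positivity) (by positivity), Real.log_pow, Real.log_pow,
    Real.log_div hN.ne' two_ne_zero] at h3
  linarith

/-- A small loss `δ` in the covering parameters keeps the masking exponent below `θ`. -/
lemma exists_masking_slack {ν r θ : ℝ} (hν : 0 < ν) (hr : Real.log 2 ^ 2 * r < θ) (hr0 : 0 ≤ r) :
    ∃ δ : ℝ, 0 < δ ∧ δ < 1 ∧ (1 + δ) * Real.exp (-((1 - δ) * (ν - δ))) < 1 ∧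
      -(ν * Real.log (1 - (1 + δ) * Real.exp (-((1 - δ) * (ν - δ))))) * r < θ := by
  have hs : ContinuousAt (fun δ : ℝ => (1 + δ) * Real.exp (-((1 - δ) * (ν - δ)))) 0 := by
    fun_prop
  have hs0 : (1 + (0 : ℝ)) * Real.exp (-((1 - 0) * (ν - 0))) = Real.exp (-ν) := by simp
  have hlt : Real.exp (-ν) < 1 := Real.exp_lt_one_iff.2 (by linarith)
  have hG : ContinuousAt (fun δ : ℝ =>
      -(ν * Real.log (1 - (1 + δ) * Real.exp (-((1 - δ) * (ν - δ))))) * r) 0 := by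
    refine ((continuousAt_const.mul ((continuousAt_const.sub hs).log ?_)).neg).mul
      continuousAt_const
    change 1 - (1 + (0 : ℝ)) * Real.exp (-((1 - 0) * (ν - 0))) ≠ 0
    rw [hs0]
    exact (sub_pos.2 hlt).ne'
  have e1 := hs.eventually_lt_const (u := 1) (by simpa only [hs0] using hlt)
  have e2 := hG.eventually_lt_const (u := θ) (by
    simp only [hs0]
    exact (mul_le_mul_of_nonneg_right (neg_mul_log_one_sub_exp_neg_le hν) hr0).trans_lt hr)
  have e3 : ∀ᶠ δ : ℝ in nhds 0, δ < 1 := eventually_lt_nhds one_pos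
  obtain ⟨δ, ⟨⟨h1, h2⟩, h3⟩, h4⟩ := ((((e1.and e2).and e3).filter_mono nhdsWithin_le_nhds).and
    (self_mem_nhdsWithin (s := Set.Ioi (0 : ℝ)))).exists
  exact ⟨δ, h4, h3, h1, h2⟩

lemma decodeSuccessProb_floor_le {N K T : ℕ} {ν δ : ℝ} (hT : 0 < T) (hK : 0 < K)
    (hKN : 2 * K ≤ N) (hν : 0 < ν) (hδ0 : 0 < δ) (hδ1 : δ < 1)
    (hs1 : (1 + δ) * Real.exp (-((1 - δ) * (ν - δ))) < 1) (hKT : (K : ℝ) ≤ δ * T)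
    (hKδ : 2 / δ ≤ K) (dec : (Fin T → Fin N → Bool) → (Fin T → Bool) → Finset (Fin N)) :
    decodeSuccessProb N K T ⌊ν * (T : ℝ) / (K : ℝ)⌋₊ dec ≤
      1 / 2 + 1 / 2 * (1 / (1 + δ) + 2 * Real.exp (-(δ / 2 * K *
        Real.exp (T / K *
          (ν * Real.log (1 - (1 + δ) * Real.exp (-((1 - δ) * (ν - δ))))))))) := by
  have hKr : (0 : ℝ) < K := by exact_mod_cast hK
  have hTr : (1 : ℝ) ≤ T := by exact_mod_cast hT
  set s : ℝ := (1 + δ) * Real.exp (-((1 - δ) * (ν - δ))) with hs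
  have hs0 : 0 < s := by positivity
  have hmle : (⌊δ * K⌋₊ : ℝ) ≤ δ * K := Nat.floor_le (by positivity)
  have hmlt : δ * K - 1 < ⌊δ * K⌋₊ := by linarith [Nat.lt_floor_add_one (δ * K)]
  have hmK : ⌊δ * K⌋₊ ≤ K := by
    have : (⌊δ * K⌋₊ : ℝ) ≤ K := by nlinarith
    exact_mod_cast this
  have hLle : (⌊ν * T / K⌋₊ : ℝ) ≤ ν * T / K := Nat.floor_le (by positivity)
  have hLlt : ν * T / K - 1 < ⌊ν * T / K⌋₊ := by linarith [Nat.lt_floor_add_one (ν * T / K)]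
  set L := ⌊ν * T / K⌋₊
  set m := ⌊δ * K⌋₊
  refine (decodeSuccessProb_le_of_cover hT hmK (by omega) hδ0 hs0 hs1.le ?_ dec).trans ?_
  · rw [hs]
    gcongr
    have hinv : (1 / T : ℝ) ≤ 1 := by
      rw [div_le_one (by linarith)]
      exact hTr
    calc (1 - 1 / T : ℝ) ^ (L * (K - m)) ≤ Real.exp (-(1 / T)) ^ (L * (K - m)) :=
          pow_le_pow_left₀ (by linarith) (Real.one_sub_le_exp_neg _) _
      _ = Real.exp (-((L * (K - m)) / T)) := by
          rw [← Real.exp_nat_mul, Nat.cast_mul, Nat.cast_sub hmK]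
          congr 1
          ring
      _ ≤ _ := by
          gcongr
          rw [le_div_iff₀ (by linarith)]
          have h1 : (1 - δ) * K ≤ K - m := by linarith
          have h2 : ν * T - K ≤ L * K := by
            have := mul_le_mul_of_nonneg_right hLlt.le hKr.le
            rwa [sub_mul, div_mul_cancel₀ _ hKr.ne', one_mul] at this
          have h3 : (L : ℝ) * ((1 - δ) * K) ≤ L * (K - m) := by gcongr
          nlinarith
  · have h1 : δ / 2 * K ≤ m := by
      rw [div_le_iff₀ hδ0] at hKδ
      linarith
    have h2 : Real.exp (T / K * (ν * Real.log (1 - s))) ≤ (1 - s) ^ L := by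
      have hpos : 0 < 1 - s := by linarith
      rw [← Real.exp_log (pow_pos hpos L), Real.log_pow]
      refine Real.exp_le_exp.2 ?_
      have hneg : Real.log (1 - s) ≤ 0 := Real.log_nonpos hpos.le (by linarith)
      calc (T / K * (ν * Real.log (1 - s)) : ℝ) = ν * T / K * Real.log (1 - s) := by ring
        _ ≤ _ := mul_le_mul_of_nonpos_right hLle hneg
    gcongr

/-- Algorithm-independent converse for near-constant column weight designs:
if `K = Θ(N^θ)` with `θ ∈ (0,1)`, the per-item weight is `L = ⌊ν·T/K⌋`, and the rate
`log₂(C(N,K))/T` has liminf exceeding `min{1, (ln 2)·(1−θ)/θ}`, then no sequence of decoding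
rules has success probability converging to `1`. -/
theorem no_decoder_above_capacity
    (θ ν a b : ℝ) (hθ0 : 0 < θ) (hθ1 : θ < 1) (hν : 0 < ν) (ha : 0 < a) (hab : a ≤ b)
    (K T : ℕ → ℕ)
    (hK : ∀ N : ℕ, a * (N : ℝ) ^ θ ≤ (K N : ℝ) ∧ (K N : ℝ) ≤ b * (N : ℝ) ^ θ)
    (hrate : min 1 (Real.log 2 * (1 - θ) / θ) <
      Filter.liminf (fun N : ℕ => Real.logb 2 (Nat.choose N (K N)) / (T N : ℝ)) atTop)
    (dec : ∀ N : ℕ, (Fin (T N) → Fin N → Bool) → (Fin (T N) → Bool) → Finset (Fin N)) :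
    ¬ Tendsto
        (fun N => decodeSuccessProb N (K N) (T N) ⌊ν * (T N : ℝ) / (K N : ℝ)⌋₊ (dec N))
        atTop (nhds 1) := by
  intro hlim
  obtain ⟨c, hc1, hc2⟩ := exists_between hrate
  have hlog2 : 0 < Real.log 2 := Real.log_pos one_lt_two
  have hb : 0 < b := ha.trans_le hab
  have hθ' : 0 < 1 - θ := by linarith
  have hc0 : 0 < c := lt_trans (lt_min one_pos (by positivity)) hc1
  have hlogN : Tendsto (fun N : ℕ => Real.log N) atTop atTop :=
    Real.tendsto_log_atTop.comp tendsto_natCast_atTop_atTop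
  have hNθ : Tendsto (fun N : ℕ => (N : ℝ) ^ θ) atTop atTop :=
    (tendsto_rpow_atTop hθ0).comp tendsto_natCast_atTop_atTop
  have hKtop : Tendsto (fun N => (K N : ℝ)) atTop atTop :=
    tendsto_atTop_mono (fun N => (hK N).1) (hNθ.const_mul_atTop ha)
  have hNpos : ∀ᶠ N : ℕ in atTop, 0 < N := eventually_gt_atTop 0
  have hKpos : ∀ᶠ N in atTop, 0 < K N := by
    filter_upwards [hKtop.eventually_gt_atTop 0] with N hN
    exact_mod_cast hN
  have hlogK : ∀ᶠ N : ℕ in atTop, Real.log a + θ * Real.log N ≤ Real.log (K N) ∧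
      Real.log (K N) ≤ Real.log b + θ * Real.log N := by
    filter_upwards [hNpos, hKpos] with N hN hKN
    have hNr : (0 : ℝ) < N := by exact_mod_cast hN
    have hKr : (0 : ℝ) < K N := by exact_mod_cast hKN
    have hpow : 0 < (N : ℝ) ^ θ := Real.rpow_pos_of_pos hNr _
    rw [← Real.log_rpow hNr, ← Real.log_mul ha.ne' hpow.ne', ← Real.log_mul hb.ne' hpow.ne']
    exact ⟨Real.log_le_log (by positivity) (hK N).1, Real.log_le_log hKr (hK N).2⟩
  have hgap : Tendsto (fun N : ℕ => (1 - θ) * Real.log N - (Real.log 2 + Real.log b))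
      atTop atTop :=
    tendsto_atTop_add_const_right _ _ (hlogN.const_mul_atTop hθ')
  have h2KN : ∀ᶠ N in atTop, 2 * K N ≤ N := by
    filter_upwards [hNpos, hKpos, hlogK, hgap.eventually_ge_atTop 0] with N hN hKN hl hg
    have hNr : (0 : ℝ) < N := by exact_mod_cast hN
    have hKr : (0 : ℝ) < K N := by exact_mod_cast hKN
    have h : Real.log (2 * K N) ≤ Real.log N := by
      rw [Real.log_mul two_ne_zero hKr.ne']
      linarith [hl.2]
    exact_mod_cast (Real.log_le_log_iff (by positivity) hNr).1 h
  have hlower : ∀ᶠ N : ℕ in atTop,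
      K N * ((1 - θ) * Real.log N - (Real.log 2 + Real.log b)) ≤
        Real.log (N.choose (K N)) := by
    filter_upwards [hKpos, hlogK, h2KN] with N hKN hl h2
    refine le_trans (mul_le_mul_of_nonneg_left ?_ (Nat.cast_nonneg _)) (le_log_choose hKN h2)
    linarith [hl.2]
  have hupper : ∀ᶠ N : ℕ in atTop,
      Real.log (N.choose (K N)) ≤ K N * ((1 - θ) * Real.log N + (1 - Real.log a)) := by
    filter_upwards [hKpos, hlogK, h2KN] with N hKN hl h2
    refine (log_choose_le hKN (by omega)).trans
      (mul_le_mul_of_nonneg_left ?_ (Nat.cast_nonneg _))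
    linarith [hl.1]
  have hlogC : Tendsto (fun N : ℕ => Real.log (N.choose (K N))) atTop atTop :=
    tendsto_atTop_mono' _ hlower (hKtop.atTop_mul_atTop₀ hgap)
  have hrate' : ∀ᶠ N : ℕ in atTop,
      0 < T N ∧ c * T N * Real.log 2 ≤ Real.log (N.choose (K N)) := by
    have hbdd : IsBoundedUnder (· ≥ ·) atTop
        (fun N : ℕ => Real.logb 2 (Nat.choose N (K N)) / (T N : ℝ)) := by
      refine isBoundedUnder_of_eventually_ge (a := 0) ?_
      filter_upwards [hlogC.eventually_ge_atTop 0] with N hN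
      rw [Real.logb]
      positivity
    filter_upwards [eventually_lt_of_lt_liminf hc2 hbdd] with N hN
    have hT : 0 < T N := by
      rcases Nat.eq_zero_or_pos (T N) with h | h
      · rw [h, Nat.cast_zero, div_zero] at hN
        linarith
      · exact h
    have hTr : (0 : ℝ) < T N := by exact_mod_cast hT
    refine ⟨hT, ?_⟩
    rw [Real.logb, div_div, lt_div_iff₀ (by positivity)] at hN
    linarith
  have hcount : ∀ᶠ N : ℕ in atTop,
      Real.log (N.choose (K N)) ≤ T N * Real.log 2 + Real.log 2 := by
    filter_upwards [hrate', h2KN, hlim.eventually_const_lt (u := 1 / 2) (by norm_num)]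
      with N hT h2 hN
    have hC : (0 : ℝ) < N.choose (K N) := by
      exact_mod_cast Nat.choose_pos (by omega)
    have h := hN.trans_le (decodeSuccessProb_le_two_pow_div hT.1 (dec N))
    rw [lt_div_iff₀ hC] at h
    have h' : (N.choose (K N) : ℝ) ≤ 2 ^ T N * 2 := by linarith
    have := Real.log_le_log hC h'
    rwa [Real.log_mul (by positivity) two_ne_zero, Real.log_pow] at this
  rcases min_lt_iff.1 hc1 with hc | hc
  · obtain ⟨N, h1, h2, h3⟩ := (hrate'.and (hcount.and
      (hlogC.eventually_gt_atTop (c * Real.log 2 / (c - 1))))).exists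
    rw [div_lt_iff₀ (by linarith)] at h3
    nlinarith [mul_le_mul_of_nonneg_left h2 hc0.le]
  · have hr : Real.log 2 ^ 2 * ((1 - θ) / (c * Real.log 2)) < θ := by
      rw [div_lt_iff₀ hθ0] at hc
      rw [← mul_div_assoc, div_lt_iff₀ (by positivity)]
      nlinarith
    obtain ⟨δ, hδ0, hδ1, hs1, hG⟩ := exists_masking_slack hν hr (by positivity)
    set s : ℝ := (1 + δ) * Real.exp (-((1 - δ) * (ν - δ))) with hs
    have hs0 : 0 < s := by positivity
    set G : ℝ := -(ν * Real.log (1 - s)) with hGdef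
    have hG0 : 0 ≤ G := by
      have := Real.log_nonpos (x := 1 - s) (by linarith) (by linarith)
      nlinarith
    have hKT : ∀ᶠ N in atTop, (K N : ℝ) ≤ δ * T N := by
      filter_upwards [hlower, hcount, hKpos,
        hgap.eventually_ge_atTop (Real.log 2 / δ + Real.log 2)] with N h1 h2 h3 h4
      have hK1 : (1 : ℝ) ≤ K N := by exact_mod_cast h3
      have h5 : K N * (Real.log 2 / δ + Real.log 2) ≤ T N * Real.log 2 + Real.log 2 :=
        (mul_le_mul_of_nonneg_left h4 (by positivity)).trans (h1.trans h2)
      have h6 : K N * (Real.log 2 / δ) ≤ T N * Real.log 2 := by nlinarith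
      rw [← mul_div_assoc, div_le_iff₀ hδ0] at h6
      nlinarith
    have hTK : ∀ᶠ N : ℕ in atTop, (T N / K N : ℝ) ≤
        ((1 - θ) * Real.log N + (1 - Real.log a)) / (c * Real.log 2) := by
      filter_upwards [hupper, hrate', hKpos] with N h1 h2 h3
      have hKr : (0 : ℝ) < K N := by exact_mod_cast h3
      rw [div_le_div_iff₀ hKr (by positivity)]
      linarith [h2.2]
    have hmask : Tendsto (fun N : ℕ => δ / 2 * K N * Real.exp (T N / K N * (-G)))
        atTop atTop := by
      have hexp : Tendsto (fun N : ℕ => δ / 2 * a * Real.exp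
          ((θ - G * ((1 - θ) / (c * Real.log 2))) * Real.log N +
            -(G * (1 - Real.log a) / (c * Real.log 2)))) atTop atTop :=
        (Real.tendsto_exp_atTop.comp (tendsto_atTop_add_const_right _ _
          (hlogN.const_mul_atTop (by linarith)))).const_mul_atTop (by positivity)
      refine tendsto_atTop_mono' _ ?_ hexp
      filter_upwards [hTK, hNpos] with N h1 h2
      have hNr : (0 : ℝ) < N := by exact_mod_cast h2
      have h3 : a * Real.exp (Real.log N * θ) ≤ K N := by
        rw [← Real.rpow_def_of_pos hNr]
        exact (hK N).1
      have h4 := mul_le_mul_of_nonneg_right h1 hG0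
      calc _ = δ / 2 * (a * Real.exp (Real.log N * θ)) *
            Real.exp (-(((1 - θ) * Real.log N + (1 - Real.log a)) / (c * Real.log 2) * G)) := by
            rw [mul_assoc, mul_assoc, mul_assoc, ← Real.exp_add]
            congr 3
            ring
        _ ≤ δ / 2 * K N * Real.exp (T N / K N * (-G)) := by
            gcongr
            linarith
    have hbound : Tendsto (fun N : ℕ => 1 / 2 + 1 / 2 * (1 / (1 + δ) + 2 * Real.exp
        (-(δ / 2 * K N * Real.exp (T N / K N * (-G)))))) atTop
        (nhds (1 / 2 + 1 / 2 * (1 / (1 + δ) + 2 * 0))) :=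
      (((Real.tendsto_exp_neg_atTop_nhds_zero.comp hmask).const_mul 2).const_add _
        |>.const_mul _).const_add _
    have hle := le_of_tendsto_of_tendsto hlim hbound (by
      filter_upwards [hrate', hKpos, h2KN, hKT, hKtop.eventually_ge_atTop (2 / δ)]
        with N h1 h2 h3 h4 h5
      rw [hGdef, neg_neg]
      exact decodeSuccessProb_floor_le h1.1 h2 h3 hν hδ0 hδ1 hs1 h4 h5 (dec N))
    have : 1 / (1 + δ) < 1 := by
      rw [div_lt_one (by linarith)]
      linarith
    linarith
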